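/- Suppose f : ℝ^p → ℝ satisfies Assumption (KL-MR), and set ρ = β / max{θ(β+2), 1}. Then there exists C > 0 such that the following holds for every ε ∈ [0, ε̄), every function v : ℝ^p → ℝ^p with ‖v(x) − ∇f(x)‖ ≤ ε for all x ∈ ℝ^p, and every x_0 ∈ ℝ^p: defining for each α > 0 the constant-step sequence x_0(α) = x_0 and x_{k+1}(α) = x_k(α) − α v(x_k(α)), if limsup_{α→0⁺} sup_{k∈ℕ} ‖x_k(α)‖ < ∞, then lim_{α→0⁺} limsup_{k→∞} dist(f(x_k(α)), vcrit_ε f) = 0 and limsup_{α→0⁺} limsup_{k→∞} dist(x_k(α), crit f) ≤ C ε^ρ. -/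

import Mathlib

open Filter MeasureTheory Metric Set Topology
open scoped ENNReal NNReal

abbrev Ep (p : ℕ) := EuclideanSpace ℝ (Fin p)

def critSet {p : ℕ} (f : Ep p → ℝ) (ε : ℝ) : Set (Ep p) := {x | ‖gradient f x‖ ≤ ε}

def vcritSet {p : ℕ} (f : Ep p → ℝ) (ε : ℝ) : Set ℝ := f '' critSet f ε

/-- An `ε`-biased gradient sequence with step sizes `αs`: `x (k+1) = x k - αs k • v k` where
`‖v k - ∇f (x k)‖ ≤ ε`. -/
def IsBiasedGradSeq {p : ℕ} (f : Ep p → ℝ) (ε : ℝ) (αs : ℕ → ℝ) (x : ℕ → Ep p) : Prop :=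
  ∃ v : ℕ → Ep p, ∀ k : ℕ, ‖v k - gradient f (x k)‖ ≤ ε ∧ x (k + 1) = x k - αs k • v k

/-- A real sequence that cannot cross points outside a closed set `T` upwards, and drops by a fixed
amount whenever it lies outside `T`, eventually stays in `T`, provided `T` has a definite germ on
the right of each point. -/
theorem eventually_mem_of_descent {g : ℕ → ℝ} {T : Set ℝ} {d m : ℝ} (hd : 0 < d)
    (habs : ∀ t, t ∉ T → ∀ k, g k ≤ t → g (k + 1) ≤ t)
    (hdrop : ∀ k, g k ∉ T → g (k + 1) ≤ g k - d) (hm : ∀ k, m ≤ g k) (hTc : IsClosed T)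
    (hT : ∀ l, (∀ᶠ t in 𝓝[>] l, t ∈ T) ∨ ∀ᶠ t in 𝓝[>] l, t ∉ T) :
    ∀ᶠ k in atTop, g k ∈ T := by
  have habs' : ∀ t, t ∉ T → ∀ k, g k ≤ t → ∀ j, k ≤ j → g j ≤ t := by
    intro t ht k hk j hj
    induction j, hj using Nat.le_induction with
    | base => exact hk
    | succ n _ ih => exact habs t ht n ih
  by_contra hcon
  have hfr : ∀ n, ∃ k, n ≤ k ∧ g k ∉ T := by
    intro n
    obtain ⟨k, hk, hk'⟩ := (frequently_atTop.1 (not_eventually.1 hcon)) n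
    exact ⟨k, hk, hk'⟩
  set A : Set ℝ := {y | ∃ k, g k = y ∧ y ∉ T} with hA
  have hAbdd : BddBelow A := ⟨m, by rintro y ⟨k, rfl, _⟩; exact hm k⟩
  have hAne : A.Nonempty := by
    obtain ⟨k, -, hk⟩ := hfr 0
    exact ⟨g k, k, rfl, hk⟩
  set l := sInf A with hl
  have hlow : ∀ k, g k ∉ T → l ≤ g k := fun k hk => csInf_le hAbdd ⟨k, rfl, hk⟩
  have happ : ∀ u, 0 < u → ∃ k, g k ∉ T ∧ g k < l + u := by
    intro u hu
    obtain ⟨y, ⟨k, rfl, hk⟩, hy⟩ := exists_lt_of_csInf_lt hAne (show sInf A < l + u by linarith)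
    exact ⟨k, hk, hy⟩
  by_cases hlT : l ∈ T
  · have hlow' : ∀ k, g k ∉ T → l < g k := fun k hk =>
      lt_of_le_of_ne (hlow k hk) (fun h => hk (h ▸ hlT))
    rcases hT l with h | h
    · obtain ⟨u, hu, hsub⟩ := mem_nhdsGT_iff_exists_Ioo_subset.1 h
      obtain ⟨k, hk, hk'⟩ := happ (u - l) (sub_pos.2 hu)
      exact hk (hsub ⟨hlow' k hk, by linarith⟩)
    · obtain ⟨u, hu, hsub⟩ := mem_nhdsGT_iff_exists_Ioo_subset.1 h
      obtain ⟨k, hk, hk'⟩ := happ d hd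
      have h1 : g (k + 1) ≤ l := by linarith [hdrop k hk]
      obtain ⟨j, hj, hjT⟩ := hfr (k + 1)
      have h2 := hlow' j hjT
      obtain ⟨t, ht1, ht2⟩ := exists_between (lt_min h2 hu)
      have := habs' t (hsub ⟨ht1, ht2.trans_le (min_le_right _ _)⟩) (k + 1) (by linarith) j hj
      linarith [min_le_left (g j) u]
  · obtain ⟨u, hu, hball⟩ := Metric.mem_nhds_iff.1 (hTc.isOpen_compl.mem_nhds hlT)
    obtain ⟨k, hk, hk'⟩ := happ d hd
    have h1 : g (k + 1) < l := by linarith [hdrop k hk]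
    obtain ⟨j, hj, hjT⟩ := hfr (k + 1)
    have ht : max (g (k + 1)) (l - u / 2) < l := max_lt h1 (by linarith)
    have ht' : max (g (k + 1)) (l - u / 2) ∉ T := by
      apply hball
      rw [Metric.mem_ball, Real.dist_eq, abs_lt]
      constructor <;> linarith [le_max_right (g (k + 1)) (l - u / 2)]
    have := habs' _ ht' (k + 1) (le_max_left _ _) j hj
    linarith [hlow j hjT]

theorem eventually_mem_or_notMem_iUnion_Icc {ι : Type*} [Finite ι] (a b : ι → ℝ) (l : ℝ) :
    (∀ᶠ t in 𝓝[>] l, t ∈ ⋃ i, Icc (a i) (b i)) ∨ ∀ᶠ t in 𝓝[>] l, t ∉ ⋃ i, Icc (a i) (b i) := by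
  have key : ∀ i, (∀ᶠ t in 𝓝[>] l, t ∈ Icc (a i) (b i)) ∨
      ∀ᶠ t in 𝓝[>] l, t ∉ Icc (a i) (b i) := by
    intro i
    rcases lt_or_ge l (a i) with h | h
    · right
      filter_upwards [Ioo_mem_nhdsGT h] with t ht ht'
      exact absurd ht'.1 (not_le.2 ht.2)
    · rcases lt_or_ge l (b i) with h' | h'
      · left
        filter_upwards [Ioo_mem_nhdsGT h'] with t ht
        exact ⟨h.trans ht.1.le, ht.2.le⟩
      · right
        filter_upwards [self_mem_nhdsWithin] with t ht ht'
        exact absurd (ht'.2.trans h') (not_le.2 ht)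
  by_cases h : ∃ i, ∀ᶠ t in 𝓝[>] l, t ∈ Icc (a i) (b i)
  · obtain ⟨i, hi⟩ := h
    left
    filter_upwards [hi] with t ht
    exact mem_iUnion.2 ⟨i, ht⟩
  · right
    have : ∀ i, ∀ᶠ t in 𝓝[>] l, t ∉ Icc (a i) (b i) := fun i =>
      (key i).resolve_left (not_exists.1 h i)
    filter_upwards [eventually_all.2 this] with t ht
    simpa only [mem_iUnion, not_exists] using ht

theorem sub_le_of_Icc_subset_iUnion {F : Finset ℝ} {r u w : ℝ} (hr : 0 ≤ r)
    (h : Icc u w ⊆ ⋃ s ∈ F, Icc (s - r) (s + r)) : w - u ≤ 2 * F.card * r := by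
  have h1 : volume (Icc u w) ≤ ∑ s ∈ F, volume (Icc (s - r) (s + r)) :=
    (measure_mono h).trans (measure_biUnion_finset_le F _)
  have h2 : ∀ s ∈ F, volume (Icc (s - r) (s + r)) = ENNReal.ofReal (2 * r) := by
    intro s _
    rw [Real.volume_Icc]
    congr 1
    ring
  rw [Finset.sum_congr rfl h2, Real.volume_Icc, Finset.sum_const, nsmul_eq_mul,
    ← ENNReal.ofReal_natCast, ← ENNReal.ofReal_mul (by positivity),
    ENNReal.ofReal_le_ofReal_iff (by positivity)] at h1
  linarith

/-- If a bounded sequence cannot cross points outside `T` upwards, and `T` is covered by finitely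
many intervals of radius `r`, then its tails oscillate by at most the total length of the cover. -/
theorem exists_tail_sub_le {g : ℕ → ℝ} {T : Set ℝ} {m m' r slack : ℝ} {F : Finset ℝ}
    (hr : 0 ≤ r) (hslack : 0 < slack)
    (habs : ∀ t, t ∉ T → ∀ k, g k ≤ t → g (k + 1) ≤ t) (hm : ∀ k, m ≤ g k)
    (hm' : ∀ k, g k ≤ m') (hT : T ⊆ ⋃ s ∈ F, Icc (s - r) (s + r)) :
    ∃ K, ∀ i j, K ≤ i → K ≤ j → g i - g j ≤ 2 * F.card * r + slack := by
  have hb : IsBoundedUnder (· ≤ ·) atTop g := isBoundedUnder_of ⟨m', hm'⟩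
  have hb' : IsBoundedUnder (· ≥ ·) atTop g := isBoundedUnder_of ⟨m, hm⟩
  have h1 : ∀ᶠ k in atTop, g k < limsup g atTop + slack / 2 :=
    eventually_lt_of_limsup_lt (by linarith) hb
  have h2 : ∃ᶠ k in atTop, limsup g atTop - slack / 2 < g k :=
    frequently_lt_of_lt_limsup hb'.isCoboundedUnder_le (by linarith)
  obtain ⟨K, hK⟩ := eventually_atTop.1 h1
  refine ⟨K, fun i j hi hj => ?_⟩
  have h3 : (limsup g atTop - slack / 2) - g j ≤ 2 * F.card * r := by
    refine sub_le_of_Icc_subset_iUnion hr (Subset.trans (fun t ht => ?_) hT)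
    by_contra htT
    obtain ⟨n, hn, hn'⟩ := (frequently_atTop.1 h2) j
    have : ∀ n, j ≤ n → g n ≤ t := by
      intro n hn
      induction n, hn using Nat.le_induction with
      | base => exact ht.1
      | succ n _ ih => exact habs t htT n ih
    linarith [this n hn, ht.2]
  linarith [hK i hi]

theorem limsup_mem_Icc {w : ℕ → ℝ} {b : ℝ} (h0 : ∀ k, 0 ≤ w k) (hb : ∀ᶠ k in atTop, w k ≤ b) :
    limsup w atTop ∈ Icc 0 b := by
  have hb' : IsBoundedUnder (· ≥ ·) atTop w := isBoundedUnder_of ⟨0, h0⟩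
  refine ⟨?_, limsup_le_of_le hb'.isCoboundedUnder_le hb⟩
  exact le_limsup_of_frequently_le (Frequently.of_forall h0) ⟨b, hb⟩

theorem continuous_gradient {p : ℕ} {f : Ep p → ℝ} (hf : ContDiff ℝ 1 f) :
    Continuous (gradient f) :=
  (InnerProductSpace.toDual ℝ (Ep p)).symm.continuous.comp (hf.continuous_fderiv one_ne_zero)

theorem norm_gradient_le {p : ℕ} {f : Ep p → ℝ} {L : ℝ≥0} (hLip : LipschitzWith L f) (x : Ep p) :
    ‖gradient f x‖ ≤ L := by
  rw [gradient, LinearIsometryEquiv.norm_map]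
  exact norm_fderiv_le_of_lipschitz ℝ hLip

/-- Descent inequality for one inexact gradient step, when the gradient varies by at most `η` along
the step. -/
theorem apply_sub_smul_le {p : ℕ} {f : Ep p → ℝ} (hf : ContDiff ℝ 1 f) {x v : Ep p}
    {α ε η : ℝ} (hα : 0 < α) (hη : 0 ≤ η) (hv : ‖v - gradient f x‖ ≤ ε)
    (hseg : ∀ y ∈ segment ℝ x (x - α • v), ‖gradient f y - gradient f x‖ ≤ η) :
    f (x - α • v) ≤ f x - α * (‖gradient f x‖ * (‖gradient f x‖ - ε)
      - η * (‖gradient f x‖ + ε)) := by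
  have hdiff : Differentiable ℝ f := hf.differentiable one_ne_zero
  have hfd : ∀ y w, fderiv ℝ f y w = inner ℝ (gradient f y) w := by
    intro y w
    rw [gradient, InnerProductSpace.toDual_symm_apply]
  have h1 := Convex.norm_image_sub_le_of_norm_fderiv_le' (𝕜 := ℝ) (f := f)
    (s := segment ℝ x (x - α • v)) (φ := fderiv ℝ f x) (C := η) (x := x) (y := x - α • v)
    (fun y _ => hdiff y)
    (fun y hy => by
      have h := hseg y hy
      rw [gradient, gradient, ← map_sub, LinearIsometryEquiv.norm_map] at h
      exact h)
    (convex_segment _ _) (left_mem_segment _ _ _) (right_mem_segment _ _ _)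
  have h2 : x - α • v - x = -(α • v) := by abel
  rw [h2, hfd, norm_neg, norm_smul, Real.norm_of_nonneg hα.le, inner_neg_right,
    inner_smul_right, Real.norm_eq_abs] at h1
  have h3 := le_of_abs_le h1
  set γ := gradient f x with hγ
  have h4 : ‖v‖ ≤ ‖γ‖ + ε := by
    have := norm_add_le (v - γ) γ
    rw [sub_add_cancel] at this
    linarith
  have h5 : inner ℝ γ v ≥ ‖γ‖ * (‖γ‖ - ε) := by
    have e1 : inner ℝ γ v = inner ℝ γ γ + inner ℝ γ (v - γ) := by
      rw [← inner_add_right]; congr 1; abel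
    have e2 : |inner ℝ γ (v - γ)| ≤ ‖γ‖ * ‖v - γ‖ := abs_real_inner_le_norm _ _
    have e3 := neg_le_of_abs_le e2
    have e4 : ‖γ‖ * ‖v - γ‖ ≤ ‖γ‖ * ε := mul_le_mul_of_nonneg_left hv (norm_nonneg _)
    rw [e1, real_inner_self_eq_norm_sq]
    nlinarith
  have h6 : α * (‖γ‖ * (‖γ‖ - ε)) ≤ α * inner ℝ γ v := mul_le_mul_of_nonneg_left h5 hα.le
  have h7 : η * (α * ‖v‖) ≤ η * (α * (‖γ‖ + ε)) := by gcongr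
  linarith

/-- `x` is an inexact gradient sequence with step `α` and bias `ε`, contained in the ball of radius
`M`, along whose steps the gradient of `f` varies by at most `η / 3`. -/
structure IsFineRun {p : ℕ} (f : Ep p → ℝ) (M α ε η : ℝ) (x v : ℕ → Ep p) : Prop where
  step : ∀ k, x (k + 1) = x k - α • v k
  bias : ∀ k, ‖v k - gradient f (x k)‖ ≤ ε
  bdd : ∀ k, ‖x k‖ ≤ M
  grad_seg : ∀ k, ∀ y ∈ segment ℝ (x k) (x (k + 1)), ‖gradient f y - gradient f (x k)‖ ≤ η / 3

namespace IsFineRun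

variable {p : ℕ} {f : Ep p → ℝ} {M α ε η : ℝ} {x v : ℕ → Ep p}

theorem descent (h : IsFineRun f M α ε η x v) (hf : ContDiff ℝ 1 f) (hα : 0 < α) (hη : 0 < η)
    (k : ℕ) :
    f (x (k + 1)) ≤ f (x k) - α * (‖gradient f (x k)‖ * (‖gradient f (x k)‖ - ε)
      - η / 3 * (‖gradient f (x k)‖ + ε)) := by
  rw [h.step k]
  exact apply_sub_smul_le hf hα (by positivity) (h.bias k) (by rw [← h.step k]; exact h.grad_seg k)

theorem drop (h : IsFineRun f M α ε η x v) (hf : ContDiff ℝ 1 f) (hα : 0 < α) (hη : 0 < η)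
    (hε : 0 ≤ ε) {k : ℕ} (hk : ε + η ≤ ‖gradient f (x k)‖) :
    f (x (k + 1)) ≤ f (x k) - α * (η ^ 2 / 3) := by
  have h1 := h.descent hf hα hη k
  have h2 : η ^ 2 / 3 ≤ ‖gradient f (x k)‖ * (‖gradient f (x k)‖ - ε)
      - η / 3 * (‖gradient f (x k)‖ + ε) := by nlinarith
  have h3 := mul_le_mul_of_nonneg_left h2 hα.le
  linarith

theorem le_of_notMem (h : IsFineRun f M α ε η x v) (hf : ContDiff ℝ 1 f) (hα : 0 < α) (hη : 0 < η)
    (hε : 0 ≤ ε) {t : ℝ} (ht : t ∉ f '' {y | ‖y‖ ≤ M ∧ ‖gradient f y‖ ≤ ε + 2 * η}) (k : ℕ)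
    (hk : f (x k) ≤ t) : f (x (k + 1)) ≤ t := by
  by_contra! hlt
  apply ht
  have hγ : ‖gradient f (x k)‖ < ε + η := by
    by_contra! hγ
    have h1 := h.drop hf hα hη hε hγ
    have : 0 < α * (η ^ 2 / 3) := by positivity
    linarith
  have hpre : IsPreconnected (segment ℝ (x k) (x (k + 1))) :=
    (convex_segment _ _).isPreconnected
  obtain ⟨y, hy, hyt⟩ := hpre.intermediate_value (left_mem_segment ℝ _ _)
    (right_mem_segment ℝ _ _) hf.continuous.continuousOn ⟨hk, hlt.le⟩
  refine ⟨y, ⟨?_, ?_⟩, hyt⟩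
  · have := (convex_closedBall (0 : Ep p) M).segment_subset
      (mem_closedBall_zero_iff.2 (h.bdd k)) (mem_closedBall_zero_iff.2 (h.bdd (k + 1))) hy
    exact mem_closedBall_zero_iff.1 this
  · have h1 := h.grad_seg k y hy
    have h2 := norm_add_le (gradient f y - gradient f (x k)) (gradient f (x k))
    rw [sub_add_cancel] at h2
    linarith

theorem eventually_mem (h : IsFineRun f M α ε η x v) (hf : ContDiff ℝ 1 f) (hα : 0 < α)
    (hη : 0 < η) (hε : 0 ≤ ε) {m : ℝ} (hm : ∀ k, m ≤ f (x k)) {ι : Type*} [Finite ι]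
    (a b : ι → ℝ) (hsub : f '' {y | ‖y‖ ≤ M ∧ ‖gradient f y‖ ≤ ε + 2 * η} ⊆
      ⋃ i, Icc (a i) (b i)) :
    ∀ᶠ k in atTop, f (x k) ∈ ⋃ i, Icc (a i) (b i) := by
  refine eventually_mem_of_descent (g := fun k => f (x k)) (d := α * (η ^ 2 / 3)) (m := m)
    (by positivity) (fun t ht k => h.le_of_notMem hf hα hη hε (fun h' => ht (hsub h')) k) ?_ hm
    (isClosed_iUnion_of_finite fun i => isClosed_Icc)
    (eventually_mem_or_notMem_iUnion_Icc a b)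
  intro k hk
  apply h.drop hf hα hη hε
  by_contra! hlt
  exact hk (hsub ⟨x k, ⟨h.bdd k, by linarith⟩, rfl⟩)

theorem norm_step_mul_le (h : IsFineRun f M α ε η x v) (hf : ContDiff ℝ 1 f) (hα : 0 < α)
    (hη : 0 < η) (hε : 0 ≤ ε) {G : ℝ} (hG : 2 * (ε + η) ≤ G) {k : ℕ}
    (hk : G ≤ ‖gradient f (x k)‖) :
    ‖x (k + 1) - x k‖ * G ≤ 6 * (f (x k) - f (x (k + 1))) := by
  have h1 := h.descent hf hα hη k
  have h2 : ‖gradient f (x k)‖ ^ 2 / 4 ≤ ‖gradient f (x k)‖ * (‖gradient f (x k)‖ - ε)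
      - η / 3 * (‖gradient f (x k)‖ + ε) := by nlinarith
  have h3 := mul_le_mul_of_nonneg_left h2 hα.le
  have h4 : ‖v k‖ ≤ 3 / 2 * ‖gradient f (x k)‖ := by
    have h5 := norm_add_le (v k - gradient f (x k)) (gradient f (x k))
    rw [sub_add_cancel] at h5
    linarith [h.bias k]
  have h6 : ‖x (k + 1) - x k‖ = α * ‖v k‖ := by
    rw [h.step k, sub_sub_cancel_left, norm_neg, norm_smul, Real.norm_of_nonneg hα.le]
  have h7 : ‖x (k + 1) - x k‖ * G ≤ α * (3 / 2 * ‖gradient f (x k)‖) * ‖gradient f (x k)‖ := by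
    have hG0 : 0 ≤ G := by linarith
    rw [h6]
    gcongr
  nlinarith

/-- Along a tail on which `f` oscillates by at most `S` and the distance to `Z` is controlled by `A`
wherever the gradient is at most `G`, the distance to `Z` is eventually small. -/
theorem eventually_infDist_le (h : IsFineRun f M α ε η x v) (hf : ContDiff ℝ 1 f) (hα : 0 < α)
    (hη : 0 < η) (hε : 0 ≤ ε) {m G S A B : ℝ} (hm : ∀ k, m ≤ f (x k))
    (hG : 2 * (ε + η) ≤ G) {Z : Set (Ep p)} (hB : ∀ k, ‖x (k + 1) - x k‖ ≤ B)
    {K : ℕ} (hS : ∀ i j, K ≤ i → K ≤ j → f (x i) - f (x j) ≤ S)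
    (hA : ∀ k, K ≤ k → ‖gradient f (x k)‖ ≤ G → infDist (x k) Z ≤ A) :
    ∀ᶠ k in atTop, infDist (x k) Z ≤ A + B + 6 * S / G := by
  have hG0 : 0 < G := by linarith
  have hS0 : 0 ≤ S := by simpa using hS K K le_rfl le_rfl
  have hB0 : 0 ≤ B := (norm_nonneg _).trans (hB 0)
  obtain ⟨K₁, hK₁, hKA⟩ : ∃ K₁, K ≤ K₁ ∧ infDist (x K₁) Z ≤ A := by
    by_contra! hcon
    have hd : ∀ n : ℕ, f (x (K + n)) ≤ f (x K) - n * (α * (η ^ 2 / 3)) := by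
      intro n
      induction n with
      | zero => simp
      | succ n ih =>
        have hγ : G < ‖gradient f (x (K + n))‖ := by
          by_contra! hle
          linarith [hA _ (Nat.le_add_right K n) hle, hcon _ (Nat.le_add_right K n)]
        have := h.drop hf hα hη hε (k := K + n) (by linarith)
        rw [← add_assoc]
        push_cast
        linarith
    obtain ⟨n, hn⟩ := exists_nat_gt ((f (x K) - m) / (α * (η ^ 2 / 3)))
    rw [div_lt_iff₀ (by positivity)] at hn
    linarith [hd n, hm (K + n)]
  have key : ∀ k, K₁ ≤ k → infDist (x k) Z ≤ A ∨
      ∃ a, K ≤ a ∧ a ≤ k ∧ (infDist (x k) Z - (A + B)) * G ≤ 6 * (f (x a) - f (x k)) := by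
    intro k hk
    induction k, hk using Nat.le_induction with
    | base => exact Or.inl hKA
    | succ k hk ih =>
      by_cases hle : infDist (x (k + 1)) Z ≤ A
      · exact Or.inl hle
      right
      have htri : infDist (x (k + 1)) Z ≤ infDist (x k) Z + ‖x (k + 1) - x k‖ := by
        rw [← dist_eq_norm]; exact infDist_le_infDist_add_dist
      by_cases hle' : infDist (x k) Z ≤ A
      · refine ⟨k + 1, by omega, le_rfl, ?_⟩
        rw [sub_self, mul_zero]
        exact mul_nonpos_of_nonpos_of_nonneg (by linarith [hB k]) hG0.le
      · obtain ⟨a, ha, hak, hle2⟩ := ih.resolve_left hle'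
        refine ⟨a, ha, by omega, ?_⟩
        have hγ : G ≤ ‖gradient f (x k)‖ := by
          by_contra! hlt
          exact hle' (hA k (by omega) hlt.le)
        have h1 := h.norm_step_mul_le hf hα hη hε hG hγ
        nlinarith
  filter_upwards [eventually_ge_atTop K₁] with k hk
  rcases key k hk with h1 | ⟨a, ha, hak, h1⟩
  · have : 0 ≤ 6 * S / G := by positivity
    linarith
  · have h2 := hS a k ha (by omega)
    have : infDist (x k) Z - (A + B) ≤ 6 * S / G := by
      rw [le_div_iff₀ hG0]
      linarith
    linarith

end IsFineRun

theorem eventually_isFineRun {p : ℕ} {f : Ep p → ℝ} (hf : ContDiff ℝ 1 f) {L : ℝ≥0}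
    (hLip : LipschitzWith L f) {ε : ℝ} {v : Ep p → Ep p}
    (hv : ∀ y, ‖v y - gradient f y‖ ≤ ε) {xs : ℝ → ℕ → Ep p}
    (hxs : ∀ α k, xs α (k + 1) = xs α k - α • v (xs α k)) {M η : ℝ} (hη : 0 < η)
    (hM : ∀ᶠ α in 𝓝[>] (0 : ℝ), ∀ k, ‖xs α k‖ ≤ M) :
    ∀ᶠ α in 𝓝[>] (0 : ℝ), IsFineRun f M α ε η (xs α) (fun k => v (xs α k)) ∧
      ∀ k, ‖xs α (k + 1) - xs α k‖ ≤ α * (L + ε) := by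
  have huc : UniformContinuousOn (gradient f) (closedBall (0 : Ep p) M) :=
    (isCompact_closedBall _ _).uniformContinuousOn_of_continuous (continuous_gradient hf).continuousOn
  obtain ⟨d, hd, hd'⟩ := Metric.uniformContinuousOn_iff.1 huc (η / 3) (by positivity)
  have hε : 0 ≤ ε := (norm_nonneg _).trans (hv 0)
  have hsmall : ∀ᶠ α in 𝓝[>] (0 : ℝ), α * (L + ε) < d := by
    have : Tendsto (fun α : ℝ => α * (L + ε)) (𝓝[>] 0) (𝓝 (0 * (L + ε))) :=
      (tendsto_id.mono_left nhdsWithin_le_nhds).mul_const _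
    rw [zero_mul] at this
    exact this.eventually_lt_const hd
  filter_upwards [hM, hsmall, self_mem_nhdsWithin] with α hMα hα hα0
  have hα0' : 0 < α := hα0
  have hstep : ∀ k, ‖xs α (k + 1) - xs α k‖ ≤ α * (L + ε) := by
    intro k
    rw [hxs α k, sub_sub_cancel_left, norm_neg, norm_smul, Real.norm_of_nonneg hα0'.le]
    gcongr
    have h5 := norm_add_le (v (xs α k) - gradient f (xs α k)) (gradient f (xs α k))
    rw [sub_add_cancel] at h5
    linarith [hv (xs α k), norm_gradient_le hLip (xs α k)]
  refine ⟨⟨hxs α, fun k => hv _, hMα, fun k y hy => ?_⟩, hstep⟩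
  have hx := mem_closedBall_zero_iff.2 (hMα k)
  have hy' := (convex_closedBall (0 : Ep p) M).segment_subset hx
    (mem_closedBall_zero_iff.2 (hMα (k + 1))) hy
  rw [← dist_eq_norm]
  refine (hd' y hy' _ hx ?_).le
  rw [dist_eq_norm]
  exact ((norm_sub_le_of_mem_segment hy).trans (hstep k)).trans_lt hα

/-- On a ball, points with gradient slightly larger than `ε` have values close to the
`ε`-critical values. -/
theorem exists_infDist_vcritSet_le {p : ℕ} {f : Ep p → ℝ} (hf : ContDiff ℝ 1 f) (M ε : ℝ) {δ : ℝ}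
    (hδ : 0 < δ) :
    ∃ η, 0 < η ∧ ∀ y, ‖y‖ ≤ M → ‖gradient f y‖ ≤ ε + 2 * η →
      infDist (f y) (vcritSet f ε) < δ := by
  set K : Set (Ep p) := closedBall 0 M ∩ {y | δ ≤ infDist (f y) (vcritSet f ε)} with hK
  have hKc : IsCompact K := (isCompact_closedBall _ _).inter_right
    (isClosed_le continuous_const ((continuous_infDist_pt _).comp hf.continuous))
  rcases K.eq_empty_or_nonempty with hne | hne
  · refine ⟨1, one_pos, fun y hy _ => ?_⟩
    by_contra! hcon
    have : y ∈ K := ⟨mem_closedBall_zero_iff.2 hy, hcon⟩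
    simp [hne] at this
  · obtain ⟨y₀, hy₀, hmin⟩ := hKc.exists_isMinOn hne (continuous_gradient hf).norm.continuousOn
    have hlt : ε < ‖gradient f y₀‖ := by
      by_contra! hle
      have h1 : infDist (f y₀) (vcritSet f ε) = 0 := infDist_zero_of_mem ⟨y₀, hle, rfl⟩
      have h2 : δ ≤ infDist (f y₀) (vcritSet f ε) := hy₀.2
      linarith
    refine ⟨(‖gradient f y₀‖ - ε) / 4, by linarith, fun y hy hγ => ?_⟩
    by_contra! hcon
    have : ‖gradient f y₀‖ ≤ ‖gradient f y‖ := hmin ⟨mem_closedBall_zero_iff.2 hy, hcon⟩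
    linarith

theorem vcritSet_mono {p : ℕ} (f : Ep p → ℝ) {ε ε' : ℝ} (h : ε ≤ ε') :
    vcritSet f ε ⊆ vcritSet f ε' :=
  image_mono fun _ hx => le_trans (show _ ≤ ε from hx) h

theorem exists_mem_Icc_abs_sub_le {a b t δ : ℝ} (hab : a ≤ b) (hδ : 0 ≤ δ)
    (ht : t ∈ Icc (a - δ) (b + δ)) : ∃ z ∈ Icc a b, |t - z| ≤ δ := by
  rcases le_total t a with h | h
  · exact ⟨a, left_mem_Icc.2 hab, abs_le.2 ⟨by linarith [ht.1], by linarith⟩⟩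
  rcases le_total t b with h' | h'
  · exact ⟨t, ⟨h, h'⟩, by simpa using hδ⟩
  · exact ⟨b, right_mem_Icc.2 hab, abs_le.2 ⟨by linarith, by linarith [ht.2]⟩⟩

theorem sub_mul_le_apply {p : ℕ} {f : Ep p → ℝ} {L : ℝ≥0} (hLip : LipschitzWith L f) {M : ℝ}
    {x : Ep p} (hx : ‖x‖ ≤ M) : f 0 - L * M ≤ f x ∧ f x ≤ f 0 + L * M := by
  have h := hLip.dist_le_mul x 0
  rw [Real.dist_eq, dist_zero_right] at h
  have h' : L * ‖x‖ ≤ L * M := by gcongr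
  have := abs_le.1 (h.trans h')
  constructor <;> linarith [this.1, this.2]

/-- The values at `ε`-critical points lie near the critical values, by the Kurdyka–Łojasiewicz
inequality. -/
theorem vcritSet_subset_iUnion_Icc {p : ℕ} {f : Ep p → ℝ} (hne : (vcritSet f 0).Nonempty)
    (hfin : (vcritSet f 0).Finite) {e c θ : ℝ} (hc : 0 < c) (hθ : 0 < θ)
    (hKL : ∀ y : Ep p, f y ∈ vcritSet f e →
      (infDist (f y) (vcritSet f 0)) ^ θ ≤ c * ‖gradient f y‖) :
    vcritSet f e ⊆ ⋃ s ∈ hfin.toFinset, Icc (s - (c * e) ^ (1 / θ)) (s + (c * e) ^ (1 / θ)) := by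
  rintro t ⟨y, hy, rfl⟩
  have h1 := (hKL y ⟨y, hy, rfl⟩).trans (mul_le_mul_of_nonneg_left hy hc.le)
  obtain ⟨s, hs, hs'⟩ := hfin.isCompact.exists_infDist_eq_dist hne (f y)
  have h2 : infDist (f y) (vcritSet f 0) ≤ (c * e) ^ (1 / θ) := by
    have := Real.rpow_le_rpow (Real.rpow_nonneg infDist_nonneg _) h1 (show 0 ≤ 1 / θ by positivity)
    rwa [← Real.rpow_mul infDist_nonneg, mul_one_div_cancel hθ.ne', Real.rpow_one] at this
  rw [hs', Real.dist_eq] at h2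
  have h3 := abs_le.1 h2
  refine mem_iUnion₂.2 ⟨s, hfin.mem_toFinset.2 hs, ?_, ?_⟩ <;> linarith [h3.1, h3.2]

theorem tendsto_limsup_infDist_vcritSet {p : ℕ} {f : Ep p → ℝ} (hf : ContDiff ℝ 1 f) {L : ℝ≥0}
    (hLip : LipschitzWith L f) {ε : ℝ} (hε : 0 ≤ ε) (hne : (vcritSet f ε).Nonempty)
    (hsegs : ∃ (n : ℕ) (a b : Fin n → ℝ), vcritSet f ε = ⋃ i, Icc (a i) (b i))
    {v : Ep p → Ep p} (hv : ∀ y, ‖v y - gradient f y‖ ≤ ε) {xs : ℝ → ℕ → Ep p}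
    (hxs : ∀ α k, xs α (k + 1) = xs α k - α • v (xs α k)) {M : ℝ}
    (hM : ∀ᶠ α in 𝓝[>] (0 : ℝ), ∀ k, ‖xs α k‖ ≤ M) :
    Tendsto (fun α : ℝ => limsup (fun k => infDist (f (xs α k)) (vcritSet f ε)) atTop)
      (𝓝[>] 0) (𝓝 0) := by
  rw [Metric.tendsto_nhds]
  intro δ hδ
  obtain ⟨n, a, b, hab⟩ := hsegs
  obtain ⟨η, hη, hη'⟩ := exists_infDist_vcritSet_le hf M ε (half_pos hδ)
  filter_upwards [eventually_isFineRun hf hLip hv hxs hη hM, self_mem_nhdsWithin] with α hrun hα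
  have hα' : 0 < α := hα
  have hmem := hrun.1.eventually_mem hf hα' hη hε
    (fun k => (sub_mul_le_apply hLip (hrun.1.bdd k)).1)
    (fun i : {i // a i ≤ b i} => a i - δ / 2) (fun i => b i + δ / 2) (by
      rintro t ⟨y, ⟨hy, hγ⟩, rfl⟩
      obtain ⟨z, hz, hyz⟩ := (infDist_lt_iff hne).1 (hη' y hy hγ)
      rw [hab] at hz
      obtain ⟨i, hi⟩ := mem_iUnion.1 hz
      have := abs_lt.1 (by rwa [Real.dist_eq] at hyz)
      exact mem_iUnion.2 ⟨⟨i, hi.1.trans hi.2⟩, by linarith [hi.1, this.1],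
        by linarith [hi.2, this.2]⟩)
  have hle : ∀ᶠ k in atTop, infDist (f (xs α k)) (vcritSet f ε) ≤ δ / 2 := by
    filter_upwards [hmem] with k hk
    obtain ⟨i, hi⟩ := mem_iUnion.1 hk
    obtain ⟨z, hz, hz'⟩ := exists_mem_Icc_abs_sub_le i.2 (half_pos hδ).le hi
    refine (infDist_le_dist_of_mem (y := z) ?_).trans (by rwa [Real.dist_eq])
    rw [hab]
    exact mem_iUnion.2 ⟨i, hz⟩
  have := limsup_mem_Icc (fun _ => infDist_nonneg) hle
  rw [Real.dist_eq, sub_zero, abs_of_nonneg this.1]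
  linarith [this.2]

/-- Comparison of the exponents and constants when the gradient threshold is `2 * e ^ (ρ / β)`. -/
theorem threshold_bound_le {e c θ β ρ A B : ℝ} (he : 0 < e) (he1 : e ≤ 1) (hc : 0 < c)
    (hθ : 0 < θ) (hβ : 0 < β) (hρ : ρ = β / max (θ * (β + 2)) 1) (hA : 0 ≤ A)
    (hB : B ≤ e ^ ρ) :
    c * (2 * e ^ (ρ / β)) ^ β + B + 6 * (A * (c * e) ^ (1 / θ) + e ^ (1 / θ)) / (2 * e ^ (ρ / β))
      ≤ (c * 2 ^ β + 1 + 3 * (A * c ^ (1 / θ) + 1)) * e ^ ρ := by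
  have hm : 0 < max (θ * (β + 2)) 1 := lt_max_of_lt_right one_pos
  have hσ : ρ / β = 1 / max (θ * (β + 2)) 1 := by
    rw [hρ]; field_simp
  have h1 : c * (2 * e ^ (ρ / β)) ^ β = c * 2 ^ β * e ^ ρ := by
    rw [Real.mul_rpow (by norm_num) (by positivity), ← Real.rpow_mul he.le,
      div_mul_cancel₀ _ hβ.ne', mul_assoc]
  have h2 : ρ ≤ 1 / θ - ρ / β := by
    have h3 : ρ + ρ / β = (β + 1) / max (θ * (β + 2)) 1 := by
      rw [hσ, hρ]; ring
    have h4 : (β + 1) / max (θ * (β + 2)) 1 ≤ 1 / θ := by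
      rw [div_le_div_iff₀ hm hθ]
      nlinarith [le_max_left (θ * (β + 2)) 1]
    linarith
  have h5 : e ^ (1 / θ - ρ / β) ≤ e ^ ρ := Real.rpow_le_rpow_of_exponent_ge he he1 h2
  have h6 : 6 * (A * (c * e) ^ (1 / θ) + e ^ (1 / θ)) / (2 * e ^ (ρ / β))
      = 3 * (A * c ^ (1 / θ) + 1) * e ^ (1 / θ - ρ / β) := by
    rw [Real.mul_rpow hc.le he.le, Real.rpow_sub he]
    have := (Real.rpow_pos_of_pos he (ρ / β)).ne'
    field_simp
    ring
  have h7 : 3 * (A * c ^ (1 / θ) + 1) * e ^ (1 / θ - ρ / β)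
      ≤ 3 * (A * c ^ (1 / θ) + 1) * e ^ ρ := by gcongr
  rw [h1, h6]
  linarith

theorem stmt16 {p : ℕ} (f : Ep p → ℝ) (hf : ContDiff ℝ 1 f)
    (L : ℝ≥0) (hL : 0 < L) (hLip : LipschitzWith L f)
    (hvc_ne : (vcritSet f 0).Nonempty) (hvc_fin : (vcritSet f 0).Finite)
    (εb : ℝ) (hεb0 : 0 < εb) (hεb1 : εb < 1)
    (hsegs : ∀ ε : ℝ, 0 ≤ ε → ε ≤ εb → ∃ (n : ℕ) (a b : Fin n → ℝ),
      vcritSet f ε = ⋃ i, Set.Icc (a i) (b i))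
    (c θ β : ℝ) (hc : 0 < c) (hθ0 : 0 ≤ θ) (hθ1 : θ < 1) (hβ : 0 < β)
    (hKL : ∀ y : Ep p, f y ∈ vcritSet f εb →
      (infDist (f y) (vcritSet f 0)) ^ θ ≤ c * ‖gradient f y‖)
    (hMR : ∀ y : Ep p, f y ∈ vcritSet f εb →
      infDist y (critSet f 0) ≤ c * ‖gradient f y‖ ^ β)
    (ρ : ℝ) (hρ : ρ = β / max (θ * (β + 2)) 1)
    :
    ∃ C : ℝ, 0 < C ∧ ∀ ε : ℝ, 0 ≤ ε → ε < εb →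
      ∀ v : Ep p → Ep p, (∀ y : Ep p, ‖v y - gradient f y‖ ≤ ε) →
        ∀ (x₀ : Ep p) (xs : ℝ → ℕ → Ep p),
          (∀ α : ℝ, xs α 0 = x₀ ∧ ∀ k : ℕ, xs α (k + 1) = xs α k - α • v (xs α k)) →
          (∃ M : ℝ, ∀ᶠ α in nhdsWithin (0:ℝ) (Set.Ioi 0), ∀ k : ℕ, ‖xs α k‖ ≤ M) →
          Tendsto (fun α : ℝ =>
              Filter.limsup (fun k => infDist (f (xs α k)) (vcritSet f ε)) atTop)
            (nhdsWithin (0:ℝ) (Set.Ioi 0)) (nhds 0) ∧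
          Filter.limsup (fun α : ℝ =>
              Filter.limsup (fun k => infDist (xs α k) (critSet f 0)) atTop)
            (nhdsWithin (0:ℝ) (Set.Ioi 0)) ≤ C * ε ^ ρ := by
  have hθ : 0 < θ := by
    refine hθ0.lt_of_ne' fun h0 => ?_
    obtain ⟨_, y, hy, rfl⟩ := hvc_ne
    have h1 := hKL y (vcritSet_mono f hεb0.le ⟨y, hy, rfl⟩)
    have h2 : ‖gradient f y‖ ≤ 0 := hy
    rw [h0, Real.rpow_zero] at h1
    nlinarith
  have hρ0 : 0 < ρ := by
    rw [hρ]
    exact div_pos hβ (lt_max_of_lt_right one_pos)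
  refine ⟨c * 2 ^ β + 1 + 3 * (2 * hvc_fin.toFinset.card * c ^ (1 / θ) + 1), by positivity, ?_⟩
  intro ε hε hεlt v hv x₀ xs hxs hbdd
  obtain ⟨M, hM⟩ := hbdd
  have hstep : ∀ α k, xs α (k + 1) = xs α k - α • v (xs α k) := fun α => (hxs α).2
  refine ⟨tendsto_limsup_infDist_vcritSet hf hLip hε (hvc_ne.mono (vcritSet_mono f hε))
    (hsegs ε hε hεlt.le) hv hstep hM, ?_⟩
  set C := c * 2 ^ β + 1 + 3 * (2 * hvc_fin.toFinset.card * c ^ (1 / θ) + 1) with hC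
  have hbound : ∀ η, 0 < η → ε + 2 * η ≤ εb →
      limsup (fun α : ℝ => limsup (fun k => infDist (xs α k) (critSet f 0)) atTop) (𝓝[>] 0)
        ≤ C * (ε + 2 * η) ^ ρ := by
    intro η hη hηb
    have he : 0 < ε + 2 * η := by positivity
    have hVe := vcritSet_mono f hηb
    have hsmall : ∀ᶠ α in 𝓝[>] (0 : ℝ), α * (L + ε) < (ε + 2 * η) ^ ρ := by
      have : Tendsto (fun α : ℝ => α * (L + ε)) (𝓝[>] 0) (𝓝 (0 * (L + ε))) :=
        (tendsto_id.mono_left nhdsWithin_le_nhds).mul_const _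
      rw [zero_mul] at this
      exact this.eventually_lt_const (by positivity)
    have hev : ∀ᶠ α in 𝓝[>] (0 : ℝ),
        limsup (fun k => infDist (xs α k) (critSet f 0)) atTop ∈ Icc 0 (C * (ε + 2 * η) ^ ρ) := by
      filter_upwards [eventually_isFineRun hf hLip hv hstep hη hM, self_mem_nhdsWithin, hsmall]
        with α hrun hα hαs
      obtain ⟨hrun, hB⟩ := hrun
      have hα' : 0 < α := hα
      refine limsup_mem_Icc (fun _ => infDist_nonneg) ?_
      have hm := fun k => sub_mul_le_apply hLip (hrun.bdd k)
      have hsub : f '' {y | ‖y‖ ≤ M ∧ ‖gradient f y‖ ≤ ε + 2 * η} ⊆ vcritSet f (ε + 2 * η) :=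
        image_mono fun y hy => hy.2
      obtain ⟨n, a, b, hab⟩ := hsegs (ε + 2 * η) he.le hηb
      have hmem := hrun.eventually_mem hf hα' hη hε (fun k => (hm k).1) a b (hab ▸ hsub)
      rw [← hab] at hmem
      obtain ⟨K₁, hK₁⟩ := eventually_atTop.1 hmem
      obtain ⟨K₂, hK₂⟩ := exists_tail_sub_le (g := fun k => f (xs α k))
        (r := (c * (ε + 2 * η)) ^ (1 / θ)) (slack := (ε + 2 * η) ^ (1 / θ))
        (by positivity) (by positivity)
        (fun t ht k => hrun.le_of_notMem hf hα' hη hε ht k)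
        (fun k => (hm k).1) (fun k => (hm k).2)
        (hsub.trans (vcritSet_subset_iUnion_Icc hvc_ne hvc_fin hc hθ
          fun y hy => hKL y (hVe hy)))
      have hσ1 : ρ / β ≤ 1 := by
        rw [hρ, div_div, mul_comm, ← div_div, div_self hβ.ne']
        exact div_le_one_of_le₀ (le_max_right _ _) (by positivity)
      have hG : 2 * (ε + η) ≤ 2 * (ε + 2 * η) ^ (ρ / β) := by
        have := Real.rpow_le_rpow_of_exponent_ge he (by linarith) hσ1
        rw [Real.rpow_one] at this
        linarith
      have hfinal := hrun.eventually_infDist_le hf hα' hη hε (fun k => (hm k).1) hG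
        (Z := critSet f 0) (A := c * (2 * (ε + 2 * η) ^ (ρ / β)) ^ β) hB (K := max K₁ K₂)
        (fun i j hi hj => hK₂ i j (le_of_max_le_right hi) (le_of_max_le_right hj))
        (fun k hk hγ => (hMR _ (hVe (hK₁ k (le_of_max_le_left hk)))).trans (by gcongr))
      filter_upwards [hfinal] with k hk
      exact hk.trans (threshold_bound_le he (by linarith) hc hθ hβ hρ (by positivity) hαs.le)
    have hcob : IsCoboundedUnder (· ≤ ·) (𝓝[>] (0 : ℝ))
        (fun α : ℝ => limsup (fun k => infDist (xs α k) (critSet f 0)) atTop) :=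
      IsBoundedUnder.isCoboundedUnder_le ⟨0, eventually_map.2 (hev.mono fun _ h => h.1)⟩
    exact limsup_le_of_le hcob (hev.mono fun _ h => h.2)
  have hlim : Tendsto (fun η : ℝ => C * (ε + 2 * η) ^ ρ) (𝓝[>] 0) (𝓝 (C * ε ^ ρ)) := by
    have hcont : Continuous fun η : ℝ => C * (ε + 2 * η) ^ ρ :=
      continuous_const.mul ((by fun_prop : Continuous fun η : ℝ => ε + 2 * η).rpow_const
        fun _ => Or.inr hρ0.le)
    simpa using (hcont.tendsto 0).mono_left nhdsWithin_le_nhds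
  refine ge_of_tendsto hlim ?_
  filter_upwards [Ioo_mem_nhdsGT (show 0 < (εb - ε) / 2 by linarith)] with η hη
  exact hbound η hη.1 (by linarith [hη.2])
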